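/- Let m ≥ 2 and n ≥ 1, and let A be an mth-order n-dimensional strong strictly semi-positive real tensor. Then for every q ∈ ℝⁿ, the tensor complementarity problem TCP(A,q) has exactly one solution. -/

import Mathlib

open Finset Filter

/-- `A x^{m-1}`: the vector whose `i`-th entry is the sum over all tuples of the
remaining `r = m-1` indices of the tensor entry times the product of components of `x`. -/
noncomputable def tApply {n r : ℕ} (A : Fin n → (Fin r → Fin n) → ℝ) (x : Fin n → ℝ) :
    Fin n → ℝ :=
  fun i => ∑ j : Fin r → Fin n, A i j * ∏ k, x (j k)

/-- A tensor is strictly semi-positive if for every nonzero nonnegative `x` there is an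
index `i` with `x i > 0` and `(A x^{m-1}) i > 0`. -/
def StrictlySemiPositive {n r : ℕ} (A : Fin n → (Fin r → Fin n) → ℝ) : Prop :=
  ∀ x : Fin n → ℝ, (∀ i, 0 ≤ x i) → x ≠ 0 → ∃ i, 0 < x i ∧ 0 < tApply A x i

/-- `f` is a P-function on the nonnegative orthant: for distinct nonnegative `x, y`,
`max_i (x_i - y_i)(f_i(x) - f_i(y)) > 0`. -/
def PFunctionOn {n : ℕ} (f : (Fin n → ℝ) → Fin n → ℝ) : Prop :=
  ∀ x y : Fin n → ℝ, (∀ i, 0 ≤ x i) → (∀ i, 0 ≤ y i) → x ≠ y →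
    ∃ i, 0 < (x i - y i) * (f x i - f y i)

/-- A tensor is strong strictly semi-positive if `x ↦ A x^{m-1} + q` is a P-function
on the nonnegative orthant for every `q`. -/
def StrongStrictlySemiPositive {n r : ℕ} (A : Fin n → (Fin r → Fin n) → ℝ) : Prop :=
  ∀ q : Fin n → ℝ, PFunctionOn (fun x i => tApply A x i + q i)

/-- The solution set of the tensor complementarity problem TCP(A, q). -/
noncomputable def TCPSol {n r : ℕ} (A : Fin n → (Fin r → Fin n) → ℝ) (q : Fin n → ℝ) :
    Set (Fin n → ℝ) :=
  {x | (∀ i, 0 ≤ x i) ∧ (∀ i, 0 ≤ tApply A x i + q i) ∧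
    ∑ i, x i * (tApply A x i + q i) = 0}

/-- The complementarity condition at a coordinate `a ∈ [0, M]` where the function has value `u`:
`u` is nonnegative if `a < M` and nonpositive if `0 < a`. -/
def IsBoxSolAt (M a u : ℝ) : Prop :=
  a * u ≤ 0 ∧ 0 ≤ (M - a) * u

/-- The solutions of the complementarity problem of `f` on the box `[0, M]ⁿ`. -/
def IsBoxSol {n : ℕ} (M : ℝ) (f : (Fin n → ℝ) → Fin n → ℝ) (x : Fin n → ℝ) : Prop :=
  (∀ i, 0 ≤ x i ∧ x i ≤ M) ∧ ∀ i, IsBoxSolAt M (x i) (f x i)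

lemma IsBoxSolAt.sub_mul_sub_nonpos {M a b u v : ℝ} (hM : 0 < M) (ha : 0 ≤ a ∧ a ≤ M)
    (hb : 0 ≤ b ∧ b ≤ M) (hu : IsBoxSolAt M a u) (hv : IsBoxSolAt M b v) :
    (a - b) * (u - v) ≤ 0 := by
  obtain ⟨hu, hu'⟩ := hu
  obtain ⟨hv, hv'⟩ := hv
  have h₁ : 0 ≤ M * ((b - a) * u) := by
    nlinarith [mul_nonneg hb.1 hu', mul_nonneg (sub_nonneg.2 hb.2) (neg_nonneg.2 hu)]
  have h₂ : 0 ≤ M * ((a - b) * v) := by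
    nlinarith [mul_nonneg ha.1 hv', mul_nonneg (sub_nonneg.2 ha.2) (neg_nonneg.2 hv)]
  have h₃ := nonneg_of_mul_nonneg_right h₁ hM
  have h₄ := nonneg_of_mul_nonneg_right h₂ hM
  linarith

lemma IsBoxSol.eq {n : ℕ} {M : ℝ} (hM : 0 < M) {f : (Fin n → ℝ) → Fin n → ℝ}
    (hf : PFunctionOn f) {x y : Fin n → ℝ} (hx : IsBoxSol M f x) (hy : IsBoxSol M f y) :
    x = y := by
  by_contra hne
  obtain ⟨i, hi⟩ := hf x y (fun i => (hx.1 i).1) (fun i => (hy.1 i).1) hne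
  exact absurd hi (not_lt.2 (IsBoxSolAt.sub_mul_sub_nonpos hM (hx.1 i) (hy.1 i)
    (hx.2 i) (hy.2 i)))

lemma PFunctionOn.cons {n : ℕ} {f : (Fin (n + 1) → ℝ) → Fin (n + 1) → ℝ}
    (hf : PFunctionOn f) {t : ℝ} (ht : 0 ≤ t) :
    PFunctionOn (fun (y : Fin n → ℝ) i => f (Fin.cons t y) i.succ) := by
  intro x y hx hy hne
  obtain ⟨i, hi⟩ := hf (Fin.cons t x) (Fin.cons t y) (Fin.cases (by simpa) (by simpa))
    (Fin.cases (by simpa) (by simpa))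
    (fun h => hne (Fin.cons_right_injective (α := fun _ => ℝ) t h))
  induction i using Fin.cases with
  | zero => simp at hi
  | succ i => exact ⟨i, by simpa using hi⟩

/-- The points of the box solving the problem in every coordinate but the first, and satisfying
a closed condition `p`, have a closed set of first coordinates. -/
lemma isClosed_image_boxSol {n : ℕ} (M : ℝ) {f : (Fin (n + 1) → ℝ) → Fin (n + 1) → ℝ}
    (hf : Continuous f) {p : Set (Fin (n + 1) → ℝ)} (hp : IsClosed p) :
    IsClosed ((fun x : Fin (n + 1) → ℝ => x 0) ''
      {x | (∀ i, 0 ≤ x i ∧ x i ≤ M) ∧ (∀ i : Fin n, IsBoxSolAt M (x i.succ) (f x i.succ)) ∧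
        x ∈ p}) := by
  have hfi : ∀ i, Continuous fun x => f x i := fun i => (continuous_apply i).comp hf
  refine (IsCompact.image (IsCompact.of_isClosed_subset
    (isCompact_Icc (a := (0 : Fin (n + 1) → ℝ)) (b := fun _ => M)) ?_ ?_)
    (continuous_apply 0)).isClosed
  · refine IsClosed.inter ?_ (IsClosed.inter ?_ hp)
    · have : IsClosed {x : Fin (n + 1) → ℝ | ∀ i, 0 ≤ x i ∧ x i ≤ M} := by
        simp only [Set.ofPred_forall, Set.ofPred_and]
        exact isClosed_iInter fun i => (isClosed_le (by fun_prop) (by fun_prop)).inter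
          (isClosed_le (by fun_prop) (by fun_prop))
      exact this
    · have : IsClosed {x : Fin (n + 1) → ℝ | ∀ i : Fin n,
          x i.succ * f x i.succ ≤ 0 ∧ 0 ≤ (M - x i.succ) * f x i.succ} := by
        simp only [Set.ofPred_forall, Set.ofPred_and]
        exact isClosed_iInter fun i => (isClosed_le (by fun_prop) (by fun_prop)).inter
          (isClosed_le (by fun_prop) (by fun_prop))
      exact this
  · exact fun x hx => ⟨fun i => (hx.1 i).1, fun i => (hx.1 i).2⟩

theorem exists_isBoxSol {n : ℕ} {M : ℝ} (hM : 0 < M) {f : (Fin n → ℝ) → Fin n → ℝ}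
    (hf : Continuous f) (hP : PFunctionOn f) : ∃ x, IsBoxSol M f x := by
  induction n with
  | zero => exact ⟨0, fun i => i.elim0, fun i => i.elim0⟩
  | succ n ih =>
    let S : Set (Fin (n + 1) → ℝ) → Set ℝ := fun p => (fun x : Fin (n + 1) → ℝ => x 0) ''
      {x | (∀ i, 0 ≤ x i ∧ x i ≤ M) ∧ (∀ i : Fin n, IsBoxSolAt M (x i.succ) (f x i.succ)) ∧
        x ∈ p}
    have hf₀ : Continuous fun x => f x 0 := (continuous_apply 0).comp hf
    have hlo := isClosed_image_boxSol M hf (isClosed_le hf₀ continuous_const :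
      IsClosed {x | f x 0 ≤ 0})
    have hhi := isClosed_image_boxSol M hf (isClosed_le continuous_const hf₀ :
      IsClosed {x | 0 ≤ f x 0})
    have hcover : Set.Icc 0 M ⊆ S {x | f x 0 ≤ 0} ∪ S {x | 0 ≤ f x 0} := by
      intro t ht
      obtain ⟨y, hy, hy'⟩ := ih (f := fun y i => f (Fin.cons t y) i.succ)
        (continuous_pi fun i => (continuous_apply i.succ).comp
          (hf.comp (continuous_const.finCons continuous_id))) (hP.cons ht.1)
      have hbox : ∀ i, 0 ≤ (Fin.cons t y : Fin (n + 1) → ℝ) i ∧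
          (Fin.cons t y : Fin (n + 1) → ℝ) i ≤ M := Fin.cases (by simpa using ht)
            (by simpa using hy)
      rcases le_total (f (Fin.cons t y) 0) 0 with h | h
      · exact .inl ⟨Fin.cons t y, ⟨hbox, by simpa using hy', h⟩, rfl⟩
      · exact .inr ⟨Fin.cons t y, ⟨hbox, by simpa using hy', h⟩, rfl⟩
    by_cases h0 : 0 ∈ S {x | 0 ≤ f x 0}
    · obtain ⟨x, ⟨hx, hx', hp⟩, h⟩ := h0
      simp only at h
      exact ⟨x, hx, Fin.cases ⟨by simp [h], by simpa [h] using mul_nonneg hM.le hp⟩ hx'⟩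
    by_cases h1 : M ∈ S {x | f x 0 ≤ 0}
    · obtain ⟨x, ⟨hx, hx', hp⟩, h⟩ := h1
      simp only at h
      exact ⟨x, hx, Fin.cases ⟨by simpa [h] using mul_nonpos_of_nonneg_of_nonpos hM.le hp,
        by simp [h]⟩ hx'⟩
    have h0' : (0 : ℝ) ∈ Set.Icc 0 M := ⟨le_rfl, hM.le⟩
    have h1' : M ∈ Set.Icc 0 M := ⟨hM.le, le_rfl⟩
    obtain ⟨t, ht, ⟨x, ⟨hx, hx', hxp⟩, hxt⟩, ⟨y, ⟨hy, hy', hyp⟩, hyt⟩⟩ :=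
      isPreconnected_closed_iff.1 isPreconnected_Icc _ _ hlo hhi hcover
        ⟨0, h0', (hcover h0').resolve_right h0⟩ ⟨M, h1', (hcover h1').resolve_left h1⟩
    have hcx : Fin.cons t (Fin.tail x) = x := by rw [← hxt]; exact Fin.cons_self_tail x
    have hcy : Fin.cons t (Fin.tail y) = y := by rw [← hyt]; exact Fin.cons_self_tail y
    have hxy : x = y := by
      rw [← hcx, ← hcy]
      congr 1
      refine IsBoxSol.eq hM (hP.cons ht.1) ⟨fun i => hx i.succ, fun i => ?_⟩
        ⟨fun i => hy i.succ, fun i => ?_⟩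
      · simpa only [hcx, Fin.tail] using hx' i
      · simpa only [hcy, Fin.tail] using hy' i
    subst hxy
    have hz : f x 0 = 0 := le_antisymm hxp hyp
    exact ⟨x, hx, Fin.cases ⟨by simp [hz], by simp [hz]⟩ hx'⟩

lemma continuous_tApply {n r : ℕ} (A : Fin n → (Fin r → Fin n) → ℝ) : Continuous (tApply A) := by
  unfold tApply
  fun_prop

lemma tApply_smul {n r : ℕ} (A : Fin n → (Fin r → Fin n) → ℝ) (t : ℝ) (x : Fin n → ℝ) :
    tApply A (t • x) = t ^ r • tApply A x := by
  ext i
  simp only [tApply, Pi.smul_apply, smul_eq_mul, Finset.mul_sum, Finset.prod_mul_distrib,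
    Finset.prod_const, Finset.card_univ, Fintype.card_fin]
  exact Finset.sum_congr rfl fun j _ => by ring

lemma tApply_zero {n r : ℕ} (hr : r ≠ 0) (A : Fin n → (Fin r → Fin n) → ℝ) :
    tApply A 0 = 0 := by
  simpa [hr] using tApply_smul A 0 0

lemma StrongStrictlySemiPositive.exists_mul_pos {n r : ℕ} (hr : r ≠ 0)
    {A : Fin n → (Fin r → Fin n) → ℝ} (hA : StrongStrictlySemiPositive A) {x : Fin n → ℝ}
    (hx : ∀ i, 0 ≤ x i) (hx0 : x ≠ 0) : ∃ i, 0 < x i * tApply A x i := by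
  simpa [tApply_zero hr] using hA 0 x 0 hx (fun _ => le_rfl) hx0

lemma StrongStrictlySemiPositive.exists_coercive {n r : ℕ} (hr : r ≠ 0)
    {A : Fin n → (Fin r → Fin n) → ℝ} (hA : StrongStrictlySemiPositive A) :
    ∃ c > 0, ∀ x : Fin n → ℝ, (∀ i, 0 ≤ x i) → x ≠ 0 →
      ∃ i, 0 < x i ∧ c * ‖x‖ ^ r ≤ tApply A x i := by
  set K : Set (Fin n → ℝ) := Metric.sphere 0 1 ∩ Set.Ici 0 with hK
  have hKc : IsCompact K := (isCompact_sphere _ _).inter_right isClosed_Ici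
  have hcont : Continuous fun x : Fin n → ℝ => ∑ i, max 0 (x i * tApply A x i) := by
    have := continuous_tApply A
    fun_prop
  have hpos : ∀ x ∈ K, 0 < ∑ i, max 0 (x i * tApply A x i) := by
    intro x hx
    obtain ⟨i, hi⟩ := hA.exists_mul_pos hr hx.2 (by
      rintro rfl
      simp [hK] at hx)
    exact Finset.sum_pos' (fun _ _ => le_max_left _ _)
      ⟨i, Finset.mem_univ i, lt_max_of_lt_right hi⟩
  obtain ⟨c, hc, hcK⟩ := hKc.exists_forall_le' hcont.continuousOn hpos
  refine ⟨c / (n + 1), by positivity, fun x hx hx0 => ?_⟩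
  have hnx : 0 < ‖x‖ := norm_pos_iff.2 hx0
  set u : Fin n → ℝ := ‖x‖⁻¹ • x with hu
  have hu0 : ∀ i, 0 ≤ u i := fun i => mul_nonneg (inv_nonneg.2 hnx.le) (hx i)
  have hunorm : ‖u‖ = 1 := by rw [hu, norm_smul, norm_inv, norm_norm, inv_mul_cancel₀ hnx.ne']
  have hsum := hcK u ⟨by simpa using hunorm, hu0⟩
  obtain ⟨i, hi⟩ : ∃ i, c / (n + 1) ≤ max 0 (u i * tApply A u i) := by
    by_contra! h
    have hle := Finset.sum_le_sum fun i (_ : i ∈ Finset.univ) => (h i).le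
    rw [Finset.sum_const, Finset.card_univ, Fintype.card_fin, nsmul_eq_mul] at hle
    have : (n : ℝ) * (c / (n + 1)) < c := by
      rw [mul_div_assoc', div_lt_iff₀ (by positivity)]
      nlinarith
    linarith
  have hd : 0 < c / (n + 1) := by positivity
  have hi' : c / (n + 1) ≤ u i * tApply A u i := (le_max_iff.1 hi).resolve_left (not_le.2 hd)
  have hui : 0 < u i := (hu0 i).lt_of_ne (by rintro h; rw [← h, zero_mul] at hi'; linarith)
  have hui1 : u i ≤ 1 := hunorm ▸ (le_abs_self _).trans (norm_le_pi_norm u i)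
  have hxu : x = ‖x‖ • u := by rw [hu, smul_inv_smul₀ hnx.ne']
  have hAu : c / (n + 1) ≤ tApply A u i := by
    have : 0 < tApply A u i := pos_of_mul_pos_right (hd.trans_le hi') hui.le
    nlinarith
  refine ⟨i, ?_, ?_⟩
  · rw [hxu]
    exact mul_pos hnx hui
  · have h := congrFun (tApply_smul A ‖x‖ u) i
    rw [← hxu] at h
    rw [h, Pi.smul_apply, smul_eq_mul, mul_comm]
    gcongr

theorem StrongStrictlySemiPositive.exists_mem_TCPSol {n r : ℕ} (hr : r ≠ 0)
    {A : Fin n → (Fin r → Fin n) → ℝ} (hA : StrongStrictlySemiPositive A) (q : Fin n → ℝ) :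
    ∃ x, x ∈ TCPSol A q := by
  obtain ⟨c, hc, hcoer⟩ := hA.exists_coercive hr
  set M : ℝ := ‖q‖ / c + 1 with hMdef
  have hM1 : 1 ≤ M := by
    have : 0 ≤ ‖q‖ / c := by positivity
    linarith
  have hM : 0 < M := by linarith
  have hcM : ‖q‖ < c * M := by
    rw [hMdef, mul_add, mul_div_cancel₀ _ hc.ne']
    linarith
  obtain ⟨x, hx, hsol⟩ := exists_isBoxSol hM (f := fun x i => tApply A x i + q i)
    (by have := continuous_tApply A; fun_prop) (hA q)
  have hlt : ∀ i, x i < M := by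
    by_contra! h
    obtain ⟨k, hk⟩ := h
    have hMx : M ≤ ‖x‖ := hk.trans ((le_abs_self _).trans (norm_le_pi_norm x k))
    obtain ⟨i, hi, hci⟩ := hcoer x (fun i => (hx i).1)
      (norm_pos_iff.1 (hM.trans_le hMx))
    have hle : tApply A x i + q i ≤ 0 := nonpos_of_mul_nonpos_right (hsol i).1 hi
    have hq : -q i ≤ ‖q‖ := (neg_le_abs _).trans (norm_le_pi_norm q i)
    have hpow : M ≤ ‖x‖ ^ r := hMx.trans (le_self_pow₀ (hM1.trans hMx) hr)
    nlinarith
  have hnonneg : ∀ i, 0 ≤ tApply A x i + q i := fun i =>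
    nonneg_of_mul_nonneg_right (hsol i).2 (sub_pos.2 (hlt i))
  exact ⟨x, fun i => (hx i).1, hnonneg, Finset.sum_eq_zero fun i _ =>
    le_antisymm (hsol i).1 (mul_nonneg (hx i).1 (hnonneg i))⟩

theorem StrongStrictlySemiPositive.eq_of_mem_TCPSol {n r : ℕ}
    {A : Fin n → (Fin r → Fin n) → ℝ} (hA : StrongStrictlySemiPositive A) {q x y : Fin n → ℝ}
    (hx : x ∈ TCPSol A q) (hy : y ∈ TCPSol A q) : x = y := by
  by_contra hne
  obtain ⟨hx, hFx, hsx⟩ := hx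
  obtain ⟨hy, hFy, hsy⟩ := hy
  obtain ⟨i, hi⟩ := hA q x y hx hy hne
  have hxi := (Finset.sum_eq_zero_iff_of_nonneg fun i _ => mul_nonneg (hx i) (hFx i)).1 hsx i
    (Finset.mem_univ i)
  have hyi := (Finset.sum_eq_zero_iff_of_nonneg fun i _ => mul_nonneg (hy i) (hFy i)).1 hsy i
    (Finset.mem_univ i)
  nlinarith [mul_nonneg (hx i) (hFy i), mul_nonneg (hy i) (hFx i)]

theorem tcp_strong_strictly_semipositive_unique_solution
    (m n : ℕ) (hm : 2 ≤ m) (hn : 1 ≤ n)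
    (A : Fin n → (Fin (m - 1) → Fin n) → ℝ)
    (hA : StrongStrictlySemiPositive A) (q : Fin n → ℝ) :
    ∃! x : Fin n → ℝ, x ∈ TCPSol A q := by
  obtain ⟨x, hx⟩ := hA.exists_mem_TCPSol (by omega) q
  exact ⟨x, hx, fun y hy => hA.eq_of_mem_TCPSol hy hx⟩
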